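/- Let 0 < p ≤ 2 and let (Φ_n)_{n≥1} be any nondecreasing sequence of positive reals with lim_{n→∞} Φ_n = +∞. Then there exists a martingale f ∈ H_p(G_m) such that Σ_{k=1}^∞ |f̂(k)|^p Φ_k / k^{2−p} = ∞. -/

import Mathlib

open MeasureTheory Filter Finset
open scoped Classical ENNReal NNReal

noncomputable section

namespace VilenkinPaper

/-- The generalized powers `M_0 = 1`, `M_{k+1} = m_k M_k`. -/
def Mseq (m : ℕ → ℕ) : ℕ → ℕ
  | 0 => 1
  | k + 1 => m k * Mseq m k

/-- The Vilenkin group `G_m = ∏_k ℤ_{m_k}`. -/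
abbrev Gm (m : ℕ → ℕ) : Type := (k : ℕ) → ZMod (m k)

/-- The `j`-th digit of `n` in the generalized number system based on `m`. -/
def digit (m : ℕ → ℕ) (n j : ℕ) : ℕ := n / Mseq m j % m j

/-- The generalized Rademacher functions `r_k(x) = exp(2πi x_k / m_k)`. -/
def rad (m : ℕ → ℕ) (k : ℕ) (x : Gm m) : ℂ :=
  Complex.exp (2 * Real.pi * Complex.I * ((x k).val : ℂ) / (m k : ℂ))

/-- The Vilenkin system `ψ_n = ∏_k r_k^{n_k}`. -/
def psi (m : ℕ → ℕ) (n : ℕ) (x : Gm m) : ℂ := ∏ᶠ k : ℕ, rad m k x ^ digit m n k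

/-- The Dirichlet kernels `D_n = ∑_{k<n} ψ_k`. -/
def Dker (m : ℕ → ℕ) (n : ℕ) (x : Gm m) : ℂ := ∑ k ∈ Finset.range n, psi m k x

/-- The interval `I_n(x)` : all `y` agreeing with `x` on the first `n` coordinates. -/
def Iset (m : ℕ → ℕ) (n : ℕ) (x : Gm m) : Set (Gm m) := {y | ∀ k < n, y k = x k}

/-- `I_n := I_n(0)`. -/
def IsetO (m : ℕ → ℕ) (n : ℕ) : Set (Gm m) := Iset m n 0

/-- `μ` is the normalized Haar (product) measure iff every interval `I_n(x)` has
measure `1 / M_n`. -/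
def IsHaarGm (m : ℕ → ℕ) (μ : Measure (Gm m)) : Prop :=
  ∀ n x, μ (Iset m n x) = ((Mseq m n : ℝ≥0∞))⁻¹

/-- The σ-algebra `F_n` generated by the intervals `{I_n(x)}`, i.e. by the first `n`
coordinates. -/
def filt (m : ℕ → ℕ) (n : ℕ) : MeasurableSpace (Gm m) :=
  MeasurableSpace.comap (fun x (k : Fin n) => x k) ⊤

/-- A (Vilenkin) martingale with respect to the filtration `F_n`. -/
def IsVMartingale (m : ℕ → ℕ) (μ : Measure (Gm m)) (f : ℕ → Gm m → ℂ) : Prop :=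
  (∀ n, Integrable (f n) μ) ∧
  (∀ n, Measurable[filt m n] (f n)) ∧
  (∀ n N, n ≤ N → μ[f N | filt m n] =ᵐ[μ] f n)

/-- Membership in the martingale Hardy space `H_p`: the maximal function
`f* = sup_n |f^{(n)}|` belongs to `L_p`. -/
def MemHp (m : ℕ → ℕ) (μ : Measure (Gm m)) (p : ℝ) (f : ℕ → Gm m → ℂ) : Prop :=
  ∫⁻ x, (⨆ n, (‖f n x‖₊ : ℝ≥0∞)) ^ p ∂μ < ⊤

/-- The `i`-th Vilenkin–Fourier coefficient of an integrable function. -/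
def fourierCoefFn (m : ℕ → ℕ) (μ : Measure (Gm m)) (g : Gm m → ℂ) (i : ℕ) : ℂ :=
  ∫ x, g x * (starRingEnd ℂ) (psi m i x) ∂μ

/-- The partial sum `S_n` built from a sequence `c` of Fourier coefficients. -/
def Spart (m : ℕ → ℕ) (c : ℕ → ℂ) (n : ℕ) (x : Gm m) : ℂ :=
  ∑ k ∈ Finset.range n, c k * psi m k x

/-- The weak `L_{p,∞}` quasinorm `sup_{λ>0} λ μ(|g| > λ)^{1/p}`. -/
def wLp (m : ℕ → ℕ) (μ : Measure (Gm m)) (p : ℝ) (g : Gm m → ℂ) : ℝ≥0∞ :=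
  ⨆ (t : ℝ) (_ : 0 < t), ENNReal.ofReal t * μ {x | t < ‖g x‖} ^ (1 / p)

/-- `|n| = max {j : n_j ≠ 0}`. -/
def maxDigit (m : ℕ → ℕ) (n : ℕ) : ℕ := sSup {j | digit m n j ≠ 0}

/-- The set `ℕ_{n_0}` of positive integers with `n_0 = n_{|n|} = 1`. -/
def Nn0 (m : ℕ → ℕ) : Set ℕ :=
  {n | 0 < n ∧ digit m n 0 = 1 ∧ digit m n (maxDigit m n) = 1}

/-- The atom `a = (M_α^{1/p-1}/M) (D_{M_{α+1}} - D_{M_α})`. -/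
def atomFun (m : ℕ → ℕ) (MM : ℕ) (p : ℝ) (a : ℕ) (x : Gm m) : ℂ :=
  (((Mseq m a : ℝ) ^ (1 / p - 1) / (MM : ℝ) : ℝ) : ℂ) *
    (Dker m (Mseq m (a + 1)) x - Dker m (Mseq m a) x)

/-- The coefficients `λ_k = Φ_{M_{α_k}}^{-1/4}`. -/
def lamSeq (m : ℕ → ℕ) (Φ : ℕ → ℝ) (α : ℕ → ℕ) (k : ℕ) : ℝ :=
  Φ (Mseq m (α k)) ^ (-(1 / 4 : ℝ))

/-- The martingale `f^{(A)} = ∑_{k : α_k < A} λ_k a_k` of the counterexample construction. -/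
def fCon (m : ℕ → ℕ) (MM : ℕ) (p : ℝ) (Φ : ℕ → ℝ) (α : ℕ → ℕ) (A : ℕ) (x : Gm m) : ℂ :=
  ∑ᶠ (k : ℕ) (_ : α k < A), (lamSeq m Φ α k : ℂ) * atomFun m MM p (α k) x

lemma Mseq_pos {m : ℕ → ℕ} (hm : ∀ k, 2 ≤ m k) (n : ℕ) : 0 < Mseq m n := by
  induction n with
  | zero => simp [Mseq]
  | succ n ih => exact Nat.mul_pos (by have := hm n; omega) ih

lemma two_mul_Mseq_le {m : ℕ → ℕ} (hm : ∀ k, 2 ≤ m k) (n : ℕ) :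
    2 * Mseq m n ≤ Mseq m (n + 1) :=
  Nat.mul_le_mul_right _ (hm n)

lemma Mseq_strictMono {m : ℕ → ℕ} (hm : ∀ k, 2 ≤ m k) : StrictMono (Mseq m) :=
  strictMono_nat_of_lt_succ fun n => by
    have := two_mul_Mseq_le hm n
    have := Mseq_pos hm n
    omega

lemma lt_Mseq_of_le {m : ℕ → ℕ} (hm : ∀ k, 2 ≤ m k) {i n : ℕ} (h : i ≤ n) : i < Mseq m n := by
  induction n generalizing i with
  | zero => simp_all [Mseq]
  | succ n ih =>
    have := two_mul_Mseq_le hm n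
    have := ih le_rfl
    omega

lemma digit_eq_zero {m : ℕ → ℕ} (hm : ∀ k, 2 ≤ m k) {i n k : ℕ} (hi : i < Mseq m n)
    (hk : n ≤ k) : digit m i k = 0 := by
  rw [digit, Nat.div_eq_of_lt (hi.trans_le ((Mseq_strictMono hm).monotone hk)), Nat.zero_mod]

lemma digit_lt {m : ℕ → ℕ} (hm : ∀ k, 2 ≤ m k) (i k : ℕ) : digit m i k < m k :=
  Nat.mod_lt _ (by have := hm k; omega)

lemma exists_digit_ne_zero {m : ℕ → ℕ} (hm : ∀ k, 2 ≤ m k) {i n : ℕ} (hi : Mseq m n ≤ i) :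
    ∃ l, n ≤ l ∧ digit m i l ≠ 0 := by
  have hex : ∃ N, i < Mseq m N := ⟨i, lt_Mseq_of_le hm le_rfl⟩
  have hN := Nat.find_spec hex
  have hmin := fun k => Nat.find_min hex (m := k)
  generalize Nat.find hex = N at hN hmin
  obtain ⟨l, rfl⟩ : ∃ l, N = l + 1 := by
    refine ⟨N - 1, ?_⟩
    rcases N with _ | N
    · have := Mseq_pos hm n
      simp [Mseq] at hN
      omega
    · simp
  have hl : Mseq m l ≤ i := not_lt.1 (hmin l (Nat.lt_succ_self l))
  refine ⟨l, ?_, ?_⟩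
  · have := (Mseq_strictMono hm).lt_iff_lt.1 (hi.trans_lt hN)
    omega
  · have hlt : i / Mseq m l < m l := by
      rw [Nat.div_lt_iff_lt_mul (Mseq_pos hm l)]
      exact hN
    rw [digit, Nat.mod_eq_of_lt hlt]
    exact (Nat.div_pos hl (Mseq_pos hm l)).ne'

lemma rad_eq_stdAddChar {m : ℕ → ℕ} (k : ℕ) [NeZero (m k)] (x : Gm m) :
    rad m k x = ZMod.stdAddChar (x k) := by
  rw [rad, ZMod.stdAddChar_apply, ZMod.toCircle_apply]

lemma psi_eq_prod {m : ℕ → ℕ} (hm : ∀ k, 2 ≤ m k) {i n : ℕ} (hi : i < Mseq m n) (x : Gm m) :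
    psi m i x = ∏ k ∈ range n, rad m k x ^ digit m i k := by
  refine finprod_eq_prod_of_mulSupport_subset _ fun k hk => ?_
  by_contra hkn
  exact hk (by simp [digit_eq_zero hm hi (not_lt.1 fun h => hkn (by simpa using h))])

lemma dependsOn_psi {m : ℕ → ℕ} (hm : ∀ k, 2 ≤ m k) {i n : ℕ} (hi : i < Mseq m n) :
    DependsOn (psi m i) (Set.Iio n) := by
  intro x y hxy
  rw [psi_eq_prod hm hi, psi_eq_prod hm hi]
  refine Finset.prod_congr rfl fun k hk => ?_
  rw [rad, rad, hxy k (by simpa using hk)]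

lemma psi_eq_one {m : ℕ → ℕ} (hm : ∀ k, 2 ≤ m k) {i n : ℕ} (hi : i < Mseq m n) {x : Gm m}
    (hx : x ∈ IsetO m n) : psi m i x = 1 := by
  rw [psi_eq_prod hm hi]
  refine Finset.prod_eq_one fun k hk => ?_
  rw [rad, hx k (by simpa using hk)]
  have : NeZero (m k) := ⟨by have := hm k; omega⟩
  simp

/-- Translating by the `l`-th unit vector multiplies `ψ_i` by a root of unity, which is not `1`
if the `l`-th digit of `i` does not vanish. -/
lemma exists_psi_add_single {m : ℕ → ℕ} (hm : ∀ k, 2 ≤ m k) {i l : ℕ} (hl : digit m i l ≠ 0) :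
    ∃ ζ : ℂ, ζ ≠ 1 ∧ ∀ x : Gm m, psi m i (x + Pi.single l 1) = ζ * psi m i x := by
  have hne : ∀ k, NeZero (m k) := fun k => ⟨by have := hm k; omega⟩
  have hi : i < Mseq m (i + l + 1) := lt_Mseq_of_le hm (by omega)
  refine ⟨ZMod.stdAddChar (1 : ZMod (m l)) ^ digit m i l, ?_, fun x => ?_⟩
  · rw [← AddChar.map_nsmul_eq_pow, ← AddChar.map_zero_eq_one (ZMod.stdAddChar (N := m l)),
      ZMod.injective_stdAddChar.ne_iff, nsmul_one, Ne, ZMod.natCast_eq_zero_iff]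
    exact fun h => absurd (Nat.le_of_dvd (by omega) h) (not_le.2 (digit_lt hm i l))
  · rw [psi_eq_prod hm hi, psi_eq_prod hm hi,
      ← Finset.mul_prod_erase _ _ (show l ∈ range (i + l + 1) by simp),
      ← Finset.mul_prod_erase _ (fun k => rad m k x ^ digit m i k)
        (show l ∈ range (i + l + 1) by simp), ← mul_assoc]
    congr 1
    · simp only [rad_eq_stdAddChar, Pi.add_apply, Pi.single_eq_same, AddChar.map_add_eq_mul,
        mul_pow, mul_comm]
    · refine Finset.prod_congr rfl fun k hk => ?_
      rw [rad, rad, Pi.add_apply, Pi.single_eq_of_ne (Finset.ne_of_mem_erase hk), add_zero]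

section Cylinders

variable {m : ℕ → ℕ} {μ : Measure (Gm m)}

lemma IsHaarGm.isProbabilityMeasure (hμ : IsHaarGm m μ) : IsProbabilityMeasure μ := by
  refine ⟨?_⟩
  have h := hμ 0 0
  rw [show Iset m 0 0 = Set.univ by ext; simp [Iset]] at h
  simpa [Mseq] using h

lemma filt_le (hm : ∀ k, 2 ≤ m k) (n : ℕ) : filt m n ≤ MeasurableSpace.pi := by
  have hne : ∀ k, NeZero (m k) := fun k => ⟨by have := hm k; omega⟩
  have hmeas : Measurable fun (x : Gm m) (k : Fin n) => x k := by fun_prop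
  rintro _ ⟨T, -, rfl⟩
  exact hmeas T.toFinite.measurableSet

/-- A function of the first `n` coordinates, as a function on the finite product. -/
lemma exists_eq_comp_restrict {f : Gm m → ℂ} {n : ℕ} (hf : DependsOn f (Set.Iio n)) :
    ∃ g : ((k : Fin n) → ZMod (m k)) → ℂ, ∀ x, f x = g fun k => x k := by
  refine ⟨fun y => f fun k => if h : k < n then y ⟨k, h⟩ else 0, fun x => hf fun k hk => ?_⟩
  simp [Set.mem_Iio.1 hk]

lemma measurable_filt_of_dependsOn {f : Gm m → ℂ} {n : ℕ} (hf : DependsOn f (Set.Iio n)) :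
    Measurable[filt m n] f := by
  obtain ⟨g, hg⟩ := exists_eq_comp_restrict hf
  rw [funext hg]
  exact (measurable_from_top (f := g)).comp (comap_measurable _)

lemma integrable_of_dependsOn (hm : ∀ k, 2 ≤ m k) [IsFiniteMeasure μ] {f : Gm m → ℂ} {n : ℕ}
    (hf : DependsOn f (Set.Iio n)) : Integrable f μ := by
  have hne : ∀ k, NeZero (m k) := fun k => ⟨by have := hm k; omega⟩
  obtain ⟨g, hg⟩ := exists_eq_comp_restrict hf
  rw [funext hg]
  exact Integrable.comp_measurable (g := g) Integrable.of_finite (by fun_prop)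

lemma integral_comp_restrict (hm : ∀ k, 2 ≤ m k) (hμ : IsHaarGm m μ) {n : ℕ}
    (g : ((k : Fin n) → ZMod (m k)) → ℂ) [∀ k : Fin n, Fintype (ZMod (m k))] :
    ∫ x, g (fun k => x k) ∂μ = (Mseq m n : ℝ)⁻¹ • ∑ y, g y := by
  have := hμ.isProbabilityMeasure
  have hne : ∀ k, NeZero (m k) := fun k => ⟨by have := hm k; omega⟩
  have hmeas : Measurable fun (x : Gm m) (k : Fin n) => x k := by fun_prop
  rw [← integral_map (f := g) hmeas.aemeasurable (measurable_of_finite g).aestronglyMeasurable,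
    integral_fintype Integrable.of_finite, Finset.smul_sum]
  refine Finset.sum_congr rfl fun y _ => ?_
  congr 1
  rw [map_measureReal_apply hmeas (measurableSet_singleton y), measureReal_def]
  have : (fun (x : Gm m) (k : Fin n) => x k) ⁻¹' {y}
      = Iset m n fun k => if h : k < n then y ⟨k, h⟩ else 0 := by
    ext x
    simp only [Set.mem_preimage, Set.mem_singleton_iff, funext_iff, Iset, Set.mem_ofPred_eq]
    exact ⟨fun h k hk => by simpa [hk] using h ⟨k, hk⟩, fun h k => by simpa using h k k.2⟩
  rw [this, hμ]
  simp

lemma integral_add_right_of_dependsOn (hm : ∀ k, 2 ≤ m k) (hμ : IsHaarGm m μ) {f : Gm m → ℂ}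
    {n : ℕ} (hf : DependsOn f (Set.Iio n)) (v : Gm m) : ∫ x, f (x + v) ∂μ = ∫ x, f x ∂μ := by
  have hne : ∀ k, NeZero (m k) := fun k => ⟨by have := hm k; omega⟩
  have : ∀ k, Fintype (ZMod (m k)) := fun k => ZMod.fintype (m k)
  obtain ⟨g, hg⟩ := exists_eq_comp_restrict hf
  simp_rw [hg]
  rw [integral_comp_restrict hm hμ g]
  exact (integral_comp_restrict hm hμ fun y => g fun k => y k + v k).trans
    (congrArg _ (Equiv.sum_comp (Equiv.addRight fun k : Fin n => v k) g))

/-- The normalized indicator of `I_n`, i.e. the Dirichlet kernel `D_{M_n}`. -/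
def cylKer (m : ℕ → ℕ) (n : ℕ) : Gm m → ℂ := (IsetO m n).indicator fun _ => (Mseq m n : ℂ)

lemma mem_IsetO_congr {n N : ℕ} (h : n ≤ N) {x y : Gm m} (hxy : ∀ k < N, x k = y k) :
    x ∈ IsetO m n ↔ y ∈ IsetO m n :=
  forall₂_congr fun k hk => by rw [hxy k (hk.trans_le h)]

lemma dependsOn_cylKer {n N : ℕ} (h : n ≤ N) : DependsOn (cylKer m n) (Set.Iio N) := by
  intro x y hxy
  simp only [cylKer, Set.indicator_apply, mem_IsetO_congr h hxy]

lemma measurableSet_IsetO (hm : ∀ k, 2 ≤ m k) (n : ℕ) : MeasurableSet (IsetO m n) := by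
  have h : Measurable (cylKer m n) :=
    (measurable_filt_of_dependsOn (dependsOn_cylKer le_rfl)).mono (filt_le hm n) le_rfl
  have hset : IsetO m n = cylKer m n ⁻¹' {0}ᶜ := by
    ext x
    simp [cylKer, (Mseq_pos hm n).ne']
  rw [hset]
  exact h (measurableSet_singleton 0).compl

lemma integral_cylKer (hm : ∀ k, 2 ≤ m k) (hμ : IsHaarGm m μ) (n : ℕ) :
    ∫ x, cylKer m n x ∂μ = 1 := by
  rw [cylKer, integral_indicator_const _ (measurableSet_IsetO hm n), measureReal_def, IsetO, hμ]
  have := (Mseq_pos hm n).ne'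
  simp [this]

lemma fourierCoefFn_cylKer (hm : ∀ k, 2 ≤ m k) (hμ : IsHaarGm m μ) (n i : ℕ) :
    fourierCoefFn m μ (cylKer m n) i = if i < Mseq m n then 1 else 0 := by
  split_ifs with hi
  · rw [← integral_cylKer hm hμ n]
    refine integral_congr_ae (ae_of_all _ fun x => ?_)
    by_cases hx : x ∈ IsetO m n
    · simp [psi_eq_one hm hi hx]
    · simp [cylKer, hx]
  · obtain ⟨l, hnl, hl⟩ := exists_digit_ne_zero hm (not_lt.1 hi)
    obtain ⟨ζ, hζ, hpsi⟩ := exists_psi_add_single hm hl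
    have hiN : i < Mseq m (i + n) := lt_Mseq_of_le hm (by omega)
    have hdep : DependsOn (fun x => cylKer m n x * (starRingEnd ℂ) (psi m i x))
        (Set.Iio (i + n)) := fun x y hxy => by
      simp only [dependsOn_cylKer (by omega : n ≤ i + n) hxy, dependsOn_psi hm hiN hxy]
    have hker : ∀ x, cylKer m n (x + Pi.single l 1) = cylKer m n x := fun x => by
      refine dependsOn_cylKer le_rfl fun k hk => ?_
      have : k ≠ l := by have := Set.mem_Iio.1 hk; omega
      simp [this]
    have key := integral_add_right_of_dependsOn hm hμ hdep (Pi.single l 1)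
    simp only [hker, hpsi, map_mul, mul_left_comm _ ((starRingEnd ℂ) ζ)] at key
    rw [integral_const_mul] at key
    have hζ' : (starRingEnd ℂ) ζ - 1 ≠ 0 := by
      rw [sub_ne_zero, Ne, ← map_one (starRingEnd ℂ), (RingHom.injective _).eq_iff]
      exact hζ
    refine (mul_eq_zero.1 ?_).resolve_left hζ'
    rw [sub_mul, one_mul, sub_eq_zero]
    exact key

lemma setIntegral_cylKer (hm : ∀ k, 2 ≤ m k) (hμ : IsHaarGm m μ) {n N : ℕ} (hn : n ≤ N)
    {S : Set (Gm m)} (hS : MeasurableSet[filt m n] S) :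
    ∫ x in S, cylKer m N x ∂μ = if 0 ∈ S then 1 else 0 := by
  have hmem : ∀ x ∈ IsetO m N, x ∈ S ↔ 0 ∈ S := by
    obtain ⟨T, -, rfl⟩ := hS
    intro x hx
    have : (fun k : Fin n => x k) = fun k : Fin n => (0 : Gm m) k :=
      funext fun k => hx k (k.2.trans_le hn)
    simp only [Set.mem_preimage, this]
  rw [← integral_indicator (filt_le hm n _ hS), ← integral_cylKer hm hμ N]
  split_ifs with h0
  · refine integral_congr_ae (ae_of_all _ fun x => ?_)
    by_cases hx : x ∈ IsetO m N <;> by_cases hxS : x ∈ S <;> simp_all [cylKer]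
  · refine integral_eq_zero_of_ae (ae_of_all _ fun x => ?_)
    by_cases hx : x ∈ IsetO m N <;> by_cases hxS : x ∈ S <;> simp_all [cylKer]

/-- The martingale `∑_{j<A} w_j (D_{M_{j+1}} - D_{M_j})`. -/
def blockMart (m : ℕ → ℕ) (w : ℕ → ℝ≥0) (A : ℕ) (x : Gm m) : ℂ :=
  ∑ j ∈ range A, ((w j : ℝ) : ℂ) * (cylKer m (j + 1) x - cylKer m j x)

lemma dependsOn_blockMart (w : ℕ → ℝ≥0) (A : ℕ) : DependsOn (blockMart m w A) (Set.Iio A) := by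
  intro x y hxy
  refine Finset.sum_congr rfl fun j hj => ?_
  have hj : j < A := by simpa using hj
  rw [dependsOn_cylKer hj hxy, dependsOn_cylKer hj.le hxy]

lemma isVMartingale_blockMart (hm : ∀ k, 2 ≤ m k) (hμ : IsHaarGm m μ) (w : ℕ → ℝ≥0) :
    IsVMartingale m μ (blockMart m w) := by
  have := hμ.isProbabilityMeasure
  have hint : ∀ A, Integrable (blockMart m w A) μ := fun A =>
    integrable_of_dependsOn hm (dependsOn_blockMart w A)
  have hmeas : ∀ A, Measurable[filt m A] (blockMart m w A) := fun A =>
    measurable_filt_of_dependsOn (dependsOn_blockMart w A)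
  refine ⟨hint, hmeas, fun n N hnN => Filter.EventuallyEq.symm ?_⟩
  refine ae_eq_condExp_of_forall_setIntegral_eq (filt_le hm n) (hint N)
    (fun S _ _ => (hint n).integrableOn) (fun S hS _ => ?_)
    (hmeas n).stronglyMeasurable.aestronglyMeasurable
  induction N, hnN using Nat.le_induction with
  | base => rfl
  | succ N hN ih =>
    have hker : ∀ j, Integrable (cylKer m j) μ := fun j =>
      integrable_of_dependsOn hm (dependsOn_cylKer le_rfl)
    have hsucc : ∀ x, blockMart m w (N + 1) x
        = blockMart m w N x + ((w N : ℝ) : ℂ) * (cylKer m (N + 1) x - cylKer m N x) :=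
      fun x => Finset.sum_range_succ _ _
    have hsub : Integrable (fun x => cylKer m (N + 1) x - cylKer m N x) μ :=
      (hker _).sub (hker _)
    simp_rw [hsucc]
    rw [integral_add (hint N).integrableOn (hsub.const_mul _).integrableOn, integral_const_mul,
      integral_sub (hker _).integrableOn (hker _).integrableOn,
      setIntegral_cylKer hm hμ (hN.trans (Nat.le_succ N)) hS, setIntegral_cylKer hm hμ hN hS,
      sub_self, mul_zero, add_zero, ih]

lemma fourierCoefFn_blockMart (hm : ∀ k, 2 ≤ m k) (hμ : IsHaarGm m μ) (w : ℕ → ℝ≥0)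
    (A i : ℕ) :
    fourierCoefFn m μ (blockMart m w A) i = ∑ j ∈ range A, ((w j : ℝ) : ℂ) *
      ((if i < Mseq m (j + 1) then 1 else 0) - (if i < Mseq m j then 1 else 0)) := by
  have := hμ.isProbabilityMeasure
  have hint : ∀ j, Integrable (fun x => cylKer m j x * (starRingEnd ℂ) (psi m i x)) μ :=
    fun j => integrable_of_dependsOn hm (n := i + j) fun x y hxy => by
      have hi : i < Mseq m (i + j) := lt_Mseq_of_le hm (by omega)
      simp only [dependsOn_cylKer (by omega : j ≤ i + j) hxy, dependsOn_psi hm hi hxy]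
  simp only [fourierCoefFn, blockMart, Finset.sum_mul, mul_assoc, sub_mul]
  have hsub : ∀ j, Integrable (fun x => cylKer m (j + 1) x * (starRingEnd ℂ) (psi m i x) -
      cylKer m j x * (starRingEnd ℂ) (psi m i x)) μ := fun j => (hint _).sub (hint _)
  rw [integral_finsetSum _ fun j _ => (hsub j).const_mul _]
  refine Finset.sum_congr rfl fun j _ => ?_
  rw [integral_const_mul, integral_sub (hint _) (hint _)]
  rw [← fourierCoefFn_cylKer hm hμ, ← fourierCoefFn_cylKer hm hμ]
  rfl

lemma sum_block_eq (hm : ∀ k, 2 ≤ m k) (w : ℕ → ℝ≥0) {A i l : ℕ} (hA : l < A)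
    (hl : Mseq m l ≤ i) (hl' : i < Mseq m (l + 1)) :
    (∑ j ∈ range A, ((w j : ℝ) : ℂ) *
      ((if i < Mseq m (j + 1) then 1 else 0) - (if i < Mseq m j then 1 else 0)))
      = ((w l : ℝ) : ℂ) := by
  have hmono := (Mseq_strictMono hm).monotone
  rw [Finset.sum_eq_single_of_mem l (by simpa using hA)]
  · simp [hl', not_lt.2 hl]
  · intro j _ hj
    rcases lt_or_gt_of_ne hj with h | h
    · have h1 : ¬ i < Mseq m (j + 1) := not_lt.2 ((hmono (by omega : j + 1 ≤ l)).trans hl)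
      have h2 : ¬ i < Mseq m j := not_lt.2 ((hmono h.le).trans hl)
      simp [h1, h2]
    · have h1 : i < Mseq m j := hl'.trans_le (hmono (by omega : l + 1 ≤ j))
      have h2 : i < Mseq m (j + 1) := h1.trans_le (hmono j.le_succ)
      simp [h1, h2]

lemma tendsto_fourierCoefFn_blockMart (hm : ∀ k, 2 ≤ m k) (hμ : IsHaarGm m μ) (w : ℕ → ℝ≥0)
    (i : ℕ) :
    Tendsto (fun A => fourierCoefFn m μ (blockMart m w A) i) atTop
      (nhds (∑ j ∈ range i, ((w j : ℝ) : ℂ) *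
        ((if i < Mseq m (j + 1) then 1 else 0) - (if i < Mseq m j then 1 else 0)))) := by
  refine tendsto_const_nhds.congr' ?_
  filter_upwards [eventually_ge_atTop i] with A hA
  rw [fourierCoefFn_blockMart hm hμ]
  refine Finset.sum_subset (Finset.range_mono hA) fun j _ hj => ?_
  have hj : i ≤ j := by simpa using hj
  simp [lt_Mseq_of_le hm hj, lt_Mseq_of_le hm (hj.trans j.le_succ)]

lemma enorm_cylKer_succ_sub_le (hm : ∀ k, 2 ≤ m k) {B : ℕ} (hB : ∀ k, m k ≤ B) (j : ℕ)
    (x : Gm m) :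
    ‖cylKer m (j + 1) x - cylKer m j x‖ₑ
      ≤ (IsetO m j).indicator (fun _ => ((B * Mseq m j : ℝ≥0) : ℝ≥0∞)) x := by
  have hsub : x ∈ IsetO m (j + 1) → x ∈ IsetO m j := fun h k hk => h k (by omega)
  have hBM : Mseq m (j + 1) ≤ B * Mseq m j := Nat.mul_le_mul_right _ (hB j)
  have hle := (Mseq_strictMono hm).monotone j.le_succ
  by_cases hj : x ∈ IsetO m j
  · rw [Set.indicator_of_mem hj, enorm_eq_nnnorm, ENNReal.coe_le_coe, ← NNReal.coe_le_coe]
    by_cases hj' : x ∈ IsetO m (j + 1)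
    · rw [cylKer, cylKer, Set.indicator_of_mem hj, Set.indicator_of_mem hj', ← Nat.cast_sub hle,
        coe_nnnorm, Complex.norm_natCast]
      refine (Nat.cast_le.2 ((Nat.sub_le _ _).trans hBM)).trans_eq ?_
      push_cast
      rfl
    · rw [cylKer, cylKer, Set.indicator_of_mem hj, Set.indicator_of_notMem hj', zero_sub,
        coe_nnnorm, norm_neg, Complex.norm_natCast]
      exact_mod_cast hle.trans hBM
  · simp [cylKer, hj, mt hsub hj]

lemma tsum_mul_rpow_le {ι : Type*} {p : ℝ} (hp : 0 < p) (g t : ι → ℝ≥0∞) :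
    (∑' j, g j * t j) ^ p ≤ (∑' j, g j) ^ p * ∑' j, t j ^ p := by
  have ht : ∀ j, t j ≤ (∑' k, t k ^ p) ^ (1 / p) := fun j => by
    rw [one_div, ENNReal.le_rpow_inv_iff hp]
    exact ENNReal.le_tsum j
  calc (∑' j, g j * t j) ^ p ≤ ((∑' j, g j) * (∑' k, t k ^ p) ^ (1 / p)) ^ p := by
        rw [← ENNReal.tsum_mul_right]
        gcongr with j
        exact ht j
    _ = _ := by
        rw [ENNReal.mul_rpow_of_nonneg _ _ hp.le, ← ENNReal.rpow_mul, one_div_mul_cancel hp.ne',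
          ENNReal.rpow_one]

lemma memHp_blockMart (hm : ∀ k, 2 ≤ m k) {B : ℕ} (hB : ∀ k, m k ≤ B) (hμ : IsHaarGm m μ)
    {p : ℝ} (hp : 0 < p) (γ : ℕ → ℝ≥0) (hγ : ∑' j, (γ j : ℝ≥0∞) ≠ ⊤)
    (hγp : ∑' j, (γ j : ℝ≥0∞) ^ p ≠ ⊤) :
    MemHp m μ p (blockMart m fun j => γ j ^ 2 * (Mseq m j : ℝ≥0) ^ (1 / p - 1)) := by
  set a : ℕ → ℝ≥0 := fun j => γ j * ((Mseq m j : ℝ≥0) ^ (1 / p - 1) * (B * Mseq m j)) with ha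
  have hpow : ∀ j, (a j : ℝ≥0∞) ^ p * (Mseq m j : ℝ≥0∞)⁻¹
      = (B : ℝ≥0∞) ^ p * (γ j : ℝ≥0∞) ^ p := fun j => by
    have hM : (Mseq m j : ℝ≥0) ≠ 0 := by exact_mod_cast (Mseq_pos hm j).ne'
    have haj : a j ^ p * (Mseq m j : ℝ≥0)⁻¹ = (B : ℝ≥0) ^ p * γ j ^ p := by
      have : a j = B * γ j * (Mseq m j : ℝ≥0) ^ (1 / p) := by
        simp only [ha, NNReal.rpow_sub_one hM]
        field_simp
      rw [this, NNReal.mul_rpow, NNReal.mul_rpow, ← NNReal.rpow_mul, one_div_mul_cancel hp.ne',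
        NNReal.rpow_one, mul_inv_cancel_right₀ hM]
    rw [← ENNReal.coe_natCast, ← ENNReal.coe_natCast, ← ENNReal.coe_inv hM,
      ← ENNReal.coe_rpow_of_nonneg _ hp.le, ← ENNReal.coe_rpow_of_nonneg _ hp.le,
      ← ENNReal.coe_rpow_of_nonneg _ hp.le, ← ENNReal.coe_mul, haj, ENNReal.coe_mul]
  have hmax : ∀ x, (⨆ n, (‖blockMart m (fun j => γ j ^ 2 * (Mseq m j : ℝ≥0) ^ (1 / p - 1)) n
      x‖₊ : ℝ≥0∞)) ≤ ∑' j, (γ j : ℝ≥0∞) * (IsetO m j).indicator (fun _ => (a j : ℝ≥0∞)) x := by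
    refine fun x => iSup_le fun n => ?_
    refine le_trans ?_ (ENNReal.sum_le_tsum (range n))
    rw [← enorm_eq_nnnorm, blockMart]
    refine (enorm_sum_le _ _).trans (Finset.sum_le_sum fun j _ => ?_)
    rw [enorm_mul]
    refine (mul_le_mul_right (enorm_cylKer_succ_sub_le hm hB j x) _).trans ?_
    by_cases hx : x ∈ IsetO m j
    · simp only [Set.indicator_of_mem hx, enorm_eq_nnnorm, Complex.nnnorm_real,
        NNReal.nnnorm_eq, ← ENNReal.coe_mul, ha]
      refine le_of_eq ?_
      congr 1
      ring
    · simp [hx]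
  rw [MemHp]
  calc ∫⁻ x, (⨆ n, (‖blockMart m (fun j => γ j ^ 2 * (Mseq m j : ℝ≥0) ^ (1 / p - 1)) n
          x‖₊ : ℝ≥0∞)) ^ p ∂μ
      ≤ ∫⁻ x, (∑' j, (γ j : ℝ≥0∞)) ^ p *
          ∑' j, (IsetO m j).indicator (fun _ => (a j : ℝ≥0∞) ^ p) x ∂μ := by
        refine lintegral_mono fun x => ?_
        refine (ENNReal.rpow_le_rpow (hmax x) hp.le).trans ((tsum_mul_rpow_le hp _ _).trans_eq ?_)
        congr 1
        refine tsum_congr fun j => ?_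
        by_cases hx : x ∈ IsetO m j <;> simp [hx, hp]
    _ = (∑' j, (γ j : ℝ≥0∞)) ^ p * ((B : ℝ≥0∞) ^ p * ∑' j, (γ j : ℝ≥0∞) ^ p) := by
        have hmeas := measurableSet_IsetO hm
        rw [lintegral_const_mul' _ _ (ENNReal.rpow_ne_top_of_nonneg hp.le hγ),
          lintegral_tsum fun j => (measurable_const.indicator (hmeas j)).aemeasurable]
        congr 1
        rw [← ENNReal.tsum_mul_left]
        refine tsum_congr fun j => ?_
        rw [lintegral_indicator_const (hmeas j), IsetO, hμ, hpow]
    _ < ⊤ := by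
        have hBp := ENNReal.rpow_lt_top_of_nonneg hp.le (ENNReal.natCast_ne_top B)
        have hγ' := ENNReal.rpow_lt_top_of_nonneg hp.le hγ
        exact ENNReal.mul_lt_top hγ' (ENNReal.mul_lt_top hBp hγp.lt_top)

end Cylinders

/-- A summable sequence of weights that is infinitely often large compared to a sequence
tending to infinity. -/
lemma exists_summable_weight {p : ℝ} (hp : 0 < p) {Ψ : ℕ → ℝ} (hΨ : Tendsto Ψ atTop atTop) :
    ∃ γ : ℕ → ℝ≥0, ∑' j, (γ j : ℝ≥0∞) ≠ ⊤ ∧ ∑' j, (γ j : ℝ≥0∞) ^ p ≠ ⊤ ∧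
      ∃ᶠ j in atTop, 1 ≤ ((γ j : ℝ) ^ 2) ^ p * Ψ j := by
  obtain ⟨α, hα, hαΨ⟩ := extraction_forall_of_eventually (P := fun k j =>
    (((((1 / 2 : ℝ≥0) ^ k : ℝ≥0) : ℝ) ^ 2) ^ p)⁻¹ ≤ Ψ j) fun k => hΨ.eventually_ge_atTop _
  set γ : ℕ → ℝ≥0 := Function.extend α (fun k => (1 / 2 : ℝ≥0) ^ k) 0 with hγ
  have hγα : ∀ k, γ (α k) = (1 / 2 : ℝ≥0) ^ k := hα.injective.extend_apply _ _
  have hγ0 : ∀ j ∉ Set.range α, γ j = 0 := fun j hj =>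
    Function.extend_apply' _ _ _ (by simpa using hj)
  have hsum : ∀ q : ℝ, 0 < q → ∑' j, (γ j : ℝ≥0∞) ^ q ≠ ⊤ := by
    intro q hq
    rw [← hα.injective.tsum_eq]
    · have : ∀ k : ℕ, (((1 / 2 : ℝ≥0) ^ k : ℝ≥0) : ℝ≥0∞) ^ q
          = (((1 / 2 : ℝ≥0) : ℝ≥0∞) ^ q) ^ k := by
        intro k
        rw [ENNReal.coe_pow, ← ENNReal.rpow_natCast, ← ENNReal.rpow_natCast,
          ← ENNReal.rpow_mul, mul_comm, ENNReal.rpow_mul]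
      simp_rw [hγα, this]
      rw [ENNReal.tsum_geometric, ENNReal.inv_ne_top, Ne, tsub_eq_zero_iff_le, not_le]
      refine ENNReal.rpow_lt_one ?_ hq
      exact_mod_cast NNReal.half_lt_self one_ne_zero
    · intro j hj
      by_contra hjα
      exact hj (by simp [hγ0 j hjα, hq])
  refine ⟨γ, by simpa using hsum 1 one_pos, hsum p hp, ?_⟩
  refine hα.tendsto_atTop.frequently (Eventually.frequently (Eventually.of_forall fun k => ?_))
  rw [hγα]
  exact (inv_le_iff_one_le_mul₀' (by positivity)).1 (hαΨ k)

lemma tsum_eq_top_of_frequently_le_sum {a : ℕ → ℝ≥0∞} {ε : ℝ≥0∞} (hε : ε ≠ 0) {s t : ℕ → ℕ}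
    (hs : Tendsto s atTop atTop)
    (h : ∃ᶠ l in atTop, ε ≤ ∑ r ∈ range (t l), a (r + s l)) : ∑' k, a k = ⊤ := by
  by_contra htop
  have hlt := (((ENNReal.tendsto_sum_nat_add a htop).comp hs).eventually
    (gt_mem_nhds hε.bot_lt))
  obtain ⟨l, hl, hl'⟩ := (h.and_eventually hlt).exists
  exact absurd (hl.trans (ENNReal.sum_le_tsum _)) (not_le.2 hl')

lemma inv_four_mul_le_block_term {p M n g φ ψ : ℝ} (hp : 0 < p) (hp2 : p ≤ 2) (hM : 0 < M)
    (hMn : M ≤ n) (hn : n ≤ 2 * M) (hg : 0 ≤ g) (hφ : 1 ≤ g ^ p * φ) (hφψ : φ ≤ ψ) :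
    (4 * M)⁻¹ ≤ (g * M ^ (1 / p - 1)) ^ p * ψ / n ^ (2 - p) := by
  have hn0 : 0 < n := hM.trans_le hMn
  have hden : n ^ (2 - p) ≤ 4 * M ^ (2 - p) := by
    calc n ^ (2 - p) ≤ (2 * M) ^ (2 - p) := Real.rpow_le_rpow hn0.le hn (by linarith)
      _ = 2 ^ (2 - p) * M ^ (2 - p) := Real.mul_rpow (by norm_num) hM.le
      _ ≤ 2 ^ (2 : ℝ) * M ^ (2 - p) := by gcongr <;> linarith
      _ = 4 * M ^ (2 - p) := by norm_num
  have hnum : M ^ (1 - p) ≤ (g * M ^ (1 / p - 1)) ^ p * ψ := by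
    rw [Real.mul_rpow hg (by positivity), ← Real.rpow_mul hM.le,
      show (1 / p - 1) * p = 1 - p by field_simp, mul_right_comm]
    refine le_mul_of_one_le_left (by positivity) (hφ.trans ?_)
    gcongr
  rw [le_div_iff₀ (by positivity)]
  refine le_trans ?_ hnum
  rw [inv_mul_le_iff₀ (by positivity)]
  refine hden.trans_eq ?_
  rw [mul_assoc, show 2 - p = 1 + (1 - p) by ring, Real.rpow_add hM, Real.rpow_one]

theorem statement0 (m : ℕ → ℕ) (hm : ∀ k, 2 ≤ m k)
    (MM : ℕ) (hMM : IsLUB (Set.range m) MM)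
    (μ : Measure (Gm m)) (hμ : IsHaarGm m μ)
    (p : ℝ) (hp0 : 0 < p) (hp2 : p ≤ 2)
    (Φ : ℕ → ℝ) (hΦpos : ∀ n, 0 < Φ n) (hΦmono : Monotone Φ)
    (hΦtop : Tendsto Φ atTop atTop) :
    ∃ (f : ℕ → Gm m → ℂ) (c : ℕ → ℂ),
      IsVMartingale m μ f ∧ MemHp m μ p f ∧
      (∀ i, Tendsto (fun k => fourierCoefFn m μ (f k) i) atTop (nhds (c i))) ∧
      ∑' k : ℕ, ENNReal.ofReal (‖c (k + 1)‖ ^ p * Φ (k + 1) / ((k + 1 : ℝ) ^ (2 - p))) = ⊤ := by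
  have hB : ∀ k, m k ≤ MM := fun k => hMM.1 ⟨k, rfl⟩
  have hMtop := (Mseq_strictMono hm).tendsto_atTop
  obtain ⟨γ, hγ, hγp, hfreq⟩ := exists_summable_weight hp0 (hΦtop.comp hMtop)
  refine ⟨_, _, isVMartingale_blockMart hm hμ _, memHp_blockMart hm hB hμ hp0 γ hγ hγp,
    tendsto_fourierCoefFn_blockMart hm hμ _, ?_⟩
  refine tsum_eq_top_of_frequently_le_sum (ε := ENNReal.ofReal 4⁻¹) (by simp)
    (s := fun l => Mseq m l - 1) (t := Mseq m) ((tendsto_sub_atTop_nat 1).comp hMtop)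
    (hfreq.mono fun l hl => ?_)
  have hM : (0 : ℝ) < Mseq m l := by exact_mod_cast Mseq_pos hm l
  have hcard : ENNReal.ofReal 4⁻¹
      = ∑ _r ∈ range (Mseq m l), ENNReal.ofReal (4 * (Mseq m l : ℝ))⁻¹ := by
    rw [Finset.sum_const, card_range, ← ENNReal.ofReal_nsmul, nsmul_eq_mul, mul_inv_rev,
      mul_inv_cancel_left₀ hM.ne']
  rw [hcard]
  refine Finset.sum_le_sum fun r hr => ENNReal.ofReal_le_ofReal ?_
  have hidx : r + (Mseq m l - 1) + 1 = r + Mseq m l := by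
    have := Mseq_pos hm l
    omega
  have hr : r < Mseq m l := by simpa using hr
  have hlt : r + Mseq m l < Mseq m (l + 1) := by
    have := two_mul_Mseq_le hm l
    omega
  rw [← Nat.cast_add_one, hidx, sum_block_eq hm _ (l := l) ?_ (Nat.le_add_left _ _) hlt,
    Complex.norm_real, NNReal.norm_eq]
  · push_cast
    refine inv_four_mul_le_block_term hp0 hp2 hM (by simp) ?_ (by positivity) hl
      (hΦmono (Nat.le_add_left _ _))
    have : (r : ℝ) ≤ Mseq m l := by exact_mod_cast hr.le
    linarith
  · exact (lt_Mseq_of_le hm le_rfl).trans_le (Nat.le_add_left _ _)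

end VilenkinPaper
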